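/- arXiv:0811.0261 — 6 statements merged into one kernel-verified Lean document; each statement's English description precedes it below -/
import Mathlib

section
/- Let H be a real inner product space, D ⊆ H a linear subspace, φ ∈ D with φ ≠ 0, and let L₋, L₊ : D → H be linear maps. Assume: ⟨L₋v, v⟩ ≥ 0 for all v ∈ D; if v ∈ D and ⟨L₋v, v⟩ = 0 then v is a scalar multiple of φ; and L₋φ = 0. Let E > 0 and let u₁, u₂ ∈ D satisfy L₋u₂ = E·u₁ and L₊u₁ = E·u₂, with (u₁, u₂) ≠ (0, 0). Then ⟨u₁, u₂⟩ > 0. -/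
open RealInnerProductSpace

/-- If `L₋` is a nonnegative operator whose null directions are multiples of
`φ`, `L₋ φ = 0`, `E > 0`, and `(u₁, u₂) ≠ (0,0)` satisfies `L₋ u₂ = E u₁`, `L₊ u₁ = E u₂`,
then `⟨u₁, u₂⟩ > 0`. -/
theorem stmt2 {H : Type*} [NormedAddCommGroup H] [InnerProductSpace ℝ H]
    (D : Submodule ℝ H) (φ : D) (hφ : φ ≠ 0)
    (Lm Lp : D →ₗ[ℝ] H)
    (hnonneg : ∀ v : D, 0 ≤ ⟪Lm v, (v : H)⟫)
    (hker : ∀ v : D, ⟪Lm v, (v : H)⟫ = 0 → ∃ c : ℝ, v = c • φ)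
    (hLmφ : Lm φ = 0)
    (E : ℝ) (hE : 0 < E) (u₁ u₂ : D)
    (h₁ : Lm u₂ = E • (u₁ : H)) (h₂ : Lp u₁ = E • (u₂ : H))
    (hne : (u₁, u₂) ≠ (0, 0)) :
    0 < ⟪(u₁ : H), (u₂ : H)⟫ := by
  have hquad : ⟪Lm u₂, (u₂ : H)⟫ = E * ⟪(u₁ : H), (u₂ : H)⟫ := by
    rw [h₁, real_inner_smul_left]
  refine pos_of_mul_pos_right (hquad ▸ (hnonneg u₂).lt_of_ne' fun h0 => hne ?_) hE.le
  obtain ⟨c, hc⟩ := hker u₂ h0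
  have hu₁ : u₁ = 0 := by
    rw [hc, map_smul, hLmφ, smul_zero] at h₁
    simpa [hE.ne'] using h₁.symm
  have hu₂ : u₂ = 0 := by
    rw [hu₁, map_zero] at h₂
    simpa [hE.ne'] using h₂.symm
  rw [hu₁, hu₂]
end

section
/- Let X be a complex Hilbert space and let J, H : X → X be continuous linear maps with J* = −J, J ∘ J = −id, and H* = H. Let z ∈ ℂ be such that z·id − J∘H is a bijective continuous linear map with continuous inverse. Then (−conj(z))·id − J∘H is also bijective with continuous inverse, and the adjoint identity ((z·id − J∘H)^{-1})* ∘ J = −J ∘ ((−conj(z)·id − J∘H)^{-1}) holds. -/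
/-- For continuous linear maps `J, H` on a complex Hilbert space with
`J* = −J`, `J² = −1`, `H* = H`, if `z·id − JH` is invertible (with two-sided continuous
inverse `R`), then `−conj z·id − JH` is invertible with some inverse `S`, and
`R* ∘ J = −(J ∘ S)`. -/
theorem stmt5 {X : Type*} [NormedAddCommGroup X] [InnerProductSpace ℂ X] [CompleteSpace X]
    (J H : X →L[ℂ] X)
    (hJadj : ContinuousLinearMap.adjoint J = -J)
    (hJJ : J * J = -1)
    (hHadj : ContinuousLinearMap.adjoint H = H)
    (z : ℂ) (R : X →L[ℂ] X)
    (hR₁ : (z • (1 : X →L[ℂ] X) - J * H) * R = 1)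
    (hR₂ : R * (z • (1 : X →L[ℂ] X) - J * H) = 1) :
    ∃ S : X →L[ℂ] X,
      ((-(starRingEnd ℂ z)) • (1 : X →L[ℂ] X) - J * H) * S = 1 ∧
      S * ((-(starRingEnd ℂ z)) • (1 : X →L[ℂ] X) - J * H) = 1 ∧
      ContinuousLinearMap.adjoint R * J = -(J * S) := by
  set P := ContinuousLinearMap.adjoint R with hP
  have hA : star (z • (1 : X →L[ℂ] X) - J * H) = (starRingEnd ℂ z) • 1 + H * J := by
    rw [← ContinuousLinearMap.star_eq_adjoint] at hJadj hHadj
    rw [star_sub, star_smul, star_one, star_mul, hJadj, hHadj, mul_neg, sub_neg_eq_add]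
    rfl
  have hPA : P * ((starRingEnd ℂ z) • (1 : X →L[ℂ] X) + H * J) = 1 := by
    rw [hP, ← ContinuousLinearMap.star_eq_adjoint, ← hA, ← star_mul, hR₁, star_one]
  have hAP : ((starRingEnd ℂ z) • (1 : X →L[ℂ] X) + H * J) * P = 1 := by
    rw [hP, ← ContinuousLinearMap.star_eq_adjoint, ← hA, ← star_mul, hR₂, star_one]
  have hB : (-(starRingEnd ℂ z)) • (1 : X →L[ℂ] X) - J * H =
      J * ((starRingEnd ℂ z) • (1 : X →L[ℂ] X) + H * J) * J := by
    rw [mul_add, add_mul, mul_smul_comm, mul_one, smul_mul_assoc, hJJ,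
      ← mul_assoc J H J, mul_assoc (J * H) J J, hJJ, mul_neg, mul_one, smul_neg, neg_smul,
      sub_eq_add_neg]
  have conj_mul (U V : X →L[ℂ] X) (hUV : U * V = 1) : J * U * J * (J * V * J) = 1 := by
    calc J * U * J * (J * V * J) = J * U * (J * J) * V * J := by simp only [mul_assoc]
      _ = -(J * (U * V) * J) := by rw [hJJ]; simp only [mul_neg, neg_mul, mul_one, mul_assoc]
      _ = 1 := by rw [hUV, mul_one, hJJ, neg_neg]
  refine ⟨J * P * J, ?_, ?_, ?_⟩
  · rw [hB]
    exact conj_mul _ _ hAP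
  · rw [hB]
    exact conj_mul _ _ hPA
  · rw [← mul_assoc, ← mul_assoc, hJJ, neg_mul, neg_mul, one_mul, neg_neg]
end

section
/- Let H be a real inner product space, D ⊆ H a linear subspace, φ ∈ D with φ ≠ 0, and let L₊, L₋ : D → H be linear maps with L₋ symmetric (⟨L₋u, v⟩ = ⟨u, L₋v⟩ for all u, v ∈ D). Assume: ⟨L₋v, v⟩ ≥ 0 for all v ∈ D; if v ∈ D and ⟨L₋v, v⟩ = 0 then v is a scalar multiple of φ; and L₋φ = 0. Let E > 0 and let V := {(u₁, u₂) ∈ D × D : L₋u₂ = E·u₁ and L₊u₁ = E·u₂}. Then the bilinear form B on V defined by B((u₁, u₂), (w₁, w₂)) := ⟨u₁, w₂⟩ is symmetric and positive definite (B(u, u) > 0 for every u ∈ V with u ≠ 0). -/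
open RealInnerProductSpace

/-- With `L₋` symmetric, nonnegative, with null directions spanned by `φ`,
`L₋ φ = 0` and `E > 0`, the bilinear form `B((u₁,u₂),(w₁,w₂)) = ⟨u₁, w₂⟩` on the space
`V = {(u₁,u₂) : L₋ u₂ = E u₁, L₊ u₁ = E u₂}` is symmetric and positive definite. -/
theorem stmt6 {H : Type*} [NormedAddCommGroup H] [InnerProductSpace ℝ H]
    (D : Submodule ℝ H) (φ : D) (hφ : φ ≠ 0)
    (Lp Lm : D →ₗ[ℝ] H)
    (hLmsym : ∀ u v : D, ⟪Lm u, (v : H)⟫ = ⟪(u : H), Lm v⟫)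
    (hnonneg : ∀ v : D, 0 ≤ ⟪Lm v, (v : H)⟫)
    (hker : ∀ v : D, ⟪Lm v, (v : H)⟫ = 0 → ∃ c : ℝ, v = c • φ)
    (hLmφ : Lm φ = 0)
    (E : ℝ) (hE : 0 < E) :
    (∀ u₁ u₂ w₁ w₂ : D,
        (Lm u₂ = E • (u₁ : H) ∧ Lp u₁ = E • (u₂ : H)) →
        (Lm w₂ = E • (w₁ : H) ∧ Lp w₁ = E • (w₂ : H)) →
        ⟪(u₁ : H), (w₂ : H)⟫ = ⟪(w₁ : H), (u₂ : H)⟫) ∧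
    (∀ u₁ u₂ : D,
        (Lm u₂ = E • (u₁ : H) ∧ Lp u₁ = E • (u₂ : H)) →
        (u₁, u₂) ≠ (0, 0) →
        0 < ⟪(u₁ : H), (u₂ : H)⟫) := by
  refine ⟨fun u₁ u₂ w₁ w₂ hu hw => ?_, fun u₁ u₂ hu hne => ?_⟩
  · have h := hLmsym u₂ w₂
    rw [hu.1, hw.1, real_inner_smul_left, real_inner_smul_right] at h
    rw [mul_left_cancel₀ hE.ne' h, real_inner_comm]
  · have hform : ⟪Lm u₂, (u₂ : H)⟫ = E * ⟪(u₁ : H), (u₂ : H)⟫ := by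
      rw [hu.1, real_inner_smul_left]
    refine pos_of_mul_pos_right ?_ hE.le
    rw [← hform]
    refine lt_of_le_of_ne (hnonneg u₂) fun h0 => hne ?_
    obtain ⟨c, hc⟩ := hker u₂ h0.symm
    have hLm : Lm u₂ = 0 := by rw [hc, map_smul, hLmφ, smul_zero]
    have hu₁ : u₁ = 0 := by simpa [hLm, hE.ne'] using hu.1.symm
    have hu₂ : u₂ = 0 := by simpa [hu₁, hE.ne'] using hu.2.symm
    rw [hu₁, hu₂]
end

section
/- There exists a constant c > 0 such that for every real T₀ ≥ 2 and every t > 0, one has ∫₀ᵗ (t − s)^{−1/2}·(T₀ + s)^{−1} ds ≤ c·(T₀ + t)^{−1/2}·log(T₀ + t). -/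
/-- A primitive of `s ↦ (t - s)^{-1/2} (T + s)^{-1}` on `(0, t)`. -/
theorem hasDerivAt_primitive_rpow_mul_inv {T t s : ℝ} (hT : 0 < T) (hs : 0 < s) (hst : s < t) :
    HasDerivAt
      (fun x : ℝ => (Real.log (T + x) - 2 * Real.log (√(T + t) + √(t - x))) / √(T + t))
      ((t - s) ^ (-(1 / 2) : ℝ) * (T + s) ^ (-1 : ℝ)) s := by
  have ha : 0 < √(T + t) := Real.sqrt_pos.2 (by linarith)
  have hr : 0 < √(t - s) := Real.sqrt_pos.2 (by linarith)
  have ha2 : √(T + t) ^ 2 = T + t := Real.sq_sqrt (by linarith)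
  have hr2 : √(t - s) ^ 2 = t - s := Real.sq_sqrt (by linarith)
  have hTs : T + s ≠ 0 := by linarith
  have h1 : HasDerivAt (fun x : ℝ => √(t - x)) (-1 / (2 * √(t - s))) s :=
    ((hasDerivAt_id s).const_sub t).sqrt (by simp only [id]; linarith)
  have h2 := (h1.const_add √(T + t)).log (by positivity)
  have h3 := ((hasDerivAt_id s).const_add T).log hTs
  refine ((h3.sub (h2.const_mul 2)).div_const √(T + t)).congr_deriv ?_
  rw [Real.rpow_neg_one, Real.rpow_neg (by linarith), ← Real.sqrt_eq_rpow]
  simp only [id]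
  have hkey : T + s = √(T + t) ^ 2 - √(t - s) ^ 2 := by linarith
  have hsum : √(T + t) + √(t - s) ≠ 0 := by positivity
  field_simp
  linear_combination hkey

theorem integral_rpow_mul_inv {T t : ℝ} (hT : 0 < T) (ht : 0 < t) :
    ∫ s in (0 : ℝ)..t, (t - s) ^ (-(1 / 2) : ℝ) * (T + s) ^ (-1 : ℝ)
      = (2 * Real.log (√(T + t) + √t) - Real.log T) / √(T + t) := by
  have ha : 0 < √(T + t) := Real.sqrt_pos.2 (by linarith)
  have hcont : ContinuousOn
      (fun x : ℝ => (Real.log (T + x) - 2 * Real.log (√(T + t) + √(t - x))) / √(T + t))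
      (Set.Icc 0 t) := by
    refine ContinuousOn.div_const (ContinuousOn.sub ?_ (continuousOn_const.mul ?_)) _
    · exact ContinuousOn.log (by fun_prop) fun x hx => by linarith [hx.1]
    · exact ContinuousOn.log (by fun_prop) fun x _ => by positivity
  have hderiv := fun s (hs : s ∈ Set.Ioo 0 t) =>
    hasDerivAt_primitive_rpow_mul_inv hT hs.1 hs.2
  have hint : IntervalIntegrable
      (fun s : ℝ => (t - s) ^ (-(1 / 2) : ℝ) * (T + s) ^ (-1 : ℝ)) MeasureTheory.volume 0 t := by
    apply intervalIntegral.intervalIntegrable_deriv_of_nonneg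
    · rwa [Set.uIcc_of_le ht.le]
    · rwa [min_eq_left ht.le, max_eq_right ht.le]
    · rw [min_eq_left ht.le, max_eq_right ht.le]
      exact fun s hs => mul_nonneg (Real.rpow_nonneg (by linarith [hs.2]) _)
        (Real.rpow_nonneg (by linarith [hs.1]) _)
  rw [intervalIntegral.integral_eq_sub_of_hasDerivAt_of_le ht.le hcont hderiv hint]
  have hlog : Real.log √(T + t) = Real.log (T + t) / 2 := Real.log_sqrt (by linarith)
  simp only [sub_self, Real.sqrt_zero, add_zero, sub_zero, hlog]
  ring

/-- There is `c > 0` such that for all `T₀ ≥ 2` and `t > 0`,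
`∫₀ᵗ (t − s)^{−1/2} (T₀ + s)^{−1} ds ≤ c (T₀ + t)^{−1/2} log(T₀ + t)`. -/
theorem stmt8 :
    ∃ c : ℝ, 0 < c ∧
      ∀ T₀ : ℝ, 2 ≤ T₀ → ∀ t : ℝ, 0 < t →
        ∫ s in (0 : ℝ)..t, (t - s) ^ (-(1 / 2) : ℝ) * (T₀ + s) ^ (-1 : ℝ)
          ≤ c * (T₀ + t) ^ (-(1 / 2) : ℝ) * Real.log (T₀ + t) := by
  refine ⟨2, two_pos, fun T hT t ht => ?_⟩
  have ha : 0 < √(T + t) := Real.sqrt_pos.2 (by linarith)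
  rw [integral_rpow_mul_inv (by linarith) ht, Real.rpow_neg (by linarith), ← Real.sqrt_eq_rpow,
    mul_right_comm, ← div_eq_mul_inv]
  refine div_le_div_of_nonneg_right ?_ ha.le
  have h1 : √t ≤ √(T + t) := Real.sqrt_le_sqrt (by linarith)
  have h2 : Real.log (√(T + t) + √t) ≤ Real.log (2 * √(T + t)) :=
    Real.log_le_log (by positivity) (by linarith)
  rw [Real.log_mul two_ne_zero ha.ne', Real.log_sqrt (by linarith)] at h2
  have h3 : Real.log 2 ≤ Real.log T := Real.log_le_log two_pos hT
  have h4 : Real.log 2 ≤ Real.log (T + t) := Real.log_le_log two_pos (by linarith)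
  linarith
end

section
/- There exist constants K > 0 and ε > 0 with the following property. Let δ > 0, T₀ ≥ 2, and c# > 0 satisfy c#·T₀^{−δ} ≤ ε. Let g : [0, ∞) → ℝ satisfy |g(t)| ≤ c#·(T₀ + t)^{−2−δ} for all t ≥ 0, and let y : [0, ∞) → [0, ∞) be differentiable with y′(t) ≤ −y(t)² + g(t) for all t ≥ 0. Then for all t ≥ 0, y(t)^{1/2} ≤ (1 + K·c#·T₀^{−δ})·(κ + t)^{−1/2}, where κ := min{T₀, 1/y(0)} (with the convention κ = T₀ when y(0) = 0). -/
/-- A nonnegative-time subsolution of `y' ≤ -y² + η (κ + t)⁻²` with `y 0 ≤ κ⁻¹` stays below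
`(1 + η) / (κ + t)`. -/
theorem le_div_of_riccati_deriv_le {y : ℝ → ℝ} {η κ : ℝ} (hη : 0 < η) (hκ : 0 < κ)
    (h_init : y 0 ≤ 1 / κ) (hd : ∀ t, 0 ≤ t → DifferentiableAt ℝ y t)
    (hy : ∀ t, 0 ≤ t → deriv y t ≤ -(y t) ^ 2 + η / (κ + t) ^ 2) {t : ℝ} (ht : 0 ≤ t) :
    y t ≤ (1 + η) / (κ + t) := by
  have hB : ∀ x, 0 ≤ x →
      HasDerivAt (fun s => (1 + η) / (κ + s)) (-(1 + η) / (κ + x) ^ 2) x := by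
    intro x hx
    have hne : κ + x ≠ 0 := by positivity
    simpa using (hasDerivAt_const x (1 + η)).fun_div ((hasDerivAt_id x).const_add κ) hne
  refine image_le_of_deriv_right_lt_deriv_boundary' (a := 0) (b := t) (f' := deriv y)
    (B := fun s => (1 + η) / (κ + s)) (B' := fun s => -(1 + η) / (κ + s) ^ 2)
    (fun x hx => (hd x hx.1).continuousAt.continuousWithinAt)
    (fun x hx => (hd x hx.1).hasDerivAt.hasDerivWithinAt) ?_
    (fun x hx => (hB x hx.1).continuousAt.continuousWithinAt)
    (fun x hx => (hB x hx.1).hasDerivWithinAt) ?_ ⟨ht, le_rfl⟩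
  · refine h_init.trans ?_
    simp only [add_zero]
    gcongr
    linarith
  · intro x hx hxB
    have hpos : 0 < κ + x := by linarith [hx.1]
    refine (hy x hx.1).trans_lt ?_
    rw [hxB, div_pow, ← neg_div, ← add_div]
    gcongr
    nlinarith

/-- Decay for the damped Riccati differential inequality
`y′ ≤ −y² + g` with `|g(t)| ≤ c#(T₀+t)^{−2−δ}` and `c# T₀^{−δ}` small:
`√(y(t)) ≤ (1 + K c# T₀^{−δ})(κ + t)^{−1/2}`, `κ = min{T₀, 1/y(0)}`
(with `κ = T₀` when `y(0) = 0`). -/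
theorem stmt9 :
    ∃ K ε : ℝ, 0 < K ∧ 0 < ε ∧
      ∀ δ T₀ cSharp : ℝ, 0 < δ → 2 ≤ T₀ → 0 < cSharp →
        cSharp * T₀ ^ (-δ) ≤ ε →
        ∀ g y : ℝ → ℝ,
          (∀ t, 0 ≤ t → |g t| ≤ cSharp * (T₀ + t) ^ (-2 - δ)) →
          (∀ t, 0 ≤ t → 0 ≤ y t) →
          (∀ t, 0 ≤ t → DifferentiableAt ℝ y t) →
          (∀ t, 0 ≤ t → deriv y t ≤ -(y t) ^ 2 + g t) →
          ∀ t, 0 ≤ t →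
            (y t) ^ ((1 : ℝ) / 2) ≤
              (1 + K * cSharp * T₀ ^ (-δ)) *
                ((if y 0 = 0 then T₀ else min T₀ (1 / y 0)) + t) ^ (-(1 : ℝ) / 2) := by
  refine ⟨1, 1, one_pos, one_pos, ?_⟩
  intro δ T₀ c hδ hT hc _ g y hg hy0 hd hy t ht
  have hTpos : 0 < T₀ := by linarith
  rw [one_mul]
  set κ : ℝ := if y 0 = 0 then T₀ else min T₀ (1 / y 0) with hκdef
  obtain ⟨hκ, hκT, h_init⟩ : 0 < κ ∧ κ ≤ T₀ ∧ y 0 ≤ 1 / κ := by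
    by_cases h : y 0 = 0
    · rw [hκdef, if_pos h, h]
      exact ⟨hTpos, le_rfl, by positivity⟩
    · have hpos : 0 < y 0 := (hy0 0 le_rfl).lt_of_ne' h
      rw [hκdef, if_neg h]
      have hm : 0 < min T₀ (1 / y 0) := by positivity
      exact ⟨hm, min_le_left _ _, (le_one_div hpos hm).2 (min_le_right _ _)⟩
  set η : ℝ := c * T₀ ^ (-δ) with hηdef
  have hη : 0 < η := by positivity
  have hforce : ∀ s, 0 ≤ s → g s ≤ η / (κ + s) ^ 2 := by
    intro s hs
    have hTs : 0 < T₀ + s := by positivity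
    calc g s ≤ c * (T₀ + s) ^ (-2 - δ) := (le_abs_self _).trans (hg s hs)
      _ = c * (T₀ + s) ^ (-δ) / (T₀ + s) ^ 2 := by
        rw [show -2 - δ = -δ - (2 : ℕ) by push_cast; ring, Real.rpow_sub_natCast hTs.ne',
          mul_div_assoc]
      _ ≤ η / (κ + s) ^ 2 := by
        have hdecay : (T₀ + s) ^ (-δ) ≤ T₀ ^ (-δ) :=
          Real.rpow_le_rpow_of_nonpos hTpos (by linarith) (by linarith)
        rw [hηdef]
        gcongr
  have hmain : y t ≤ (1 + η) / (κ + t) :=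
    le_div_of_riccati_deriv_le hη hκ h_init hd
      (fun s hs => (hy s hs).trans (by linarith [hforce s hs])) ht
  have hκt : 0 < κ + t := by positivity
  calc y t ^ ((1 : ℝ) / 2) ≤ ((1 + η) / (κ + t)) ^ ((1 : ℝ) / 2) :=
        Real.rpow_le_rpow (hy0 t ht) hmain (by norm_num)
    _ = (1 + η) ^ ((1 : ℝ) / 2) * (κ + t) ^ (-(1 : ℝ) / 2) := by
        rw [Real.div_rpow (by positivity) hκt.le, neg_div, Real.rpow_neg hκt.le, div_eq_mul_inv]
    _ ≤ (1 + η) * (κ + t) ^ (-(1 : ℝ) / 2) := by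
        gcongr
        exact Real.rpow_le_self_of_one_le (by linarith) (by norm_num)
end

section
/- Let P be a polynomial in two variables with nonnegative real coefficients, let c > 0 and S ≥ 0, and define Σ := [0, 2c(S+1)] × [0, 2] × [0, 1] ⊆ ℝ³ and, for ε, δ ≥ 0, the map F_{ε,δ} : ℝ³ → ℝ³ by F_{ε,δ}(M, Z, R) := (c(S+1) + (δ+ε)·P(M, Z), 1 + ε·P(M, Z), δ + ε·P(M, Z)). Then there exists δ₀ > 0 such that for all ε, δ ∈ [0, δ₀]: (i) there is a unique (M̃, Z̃, R̃) ∈ Σ with F_{ε,δ}(M̃, Z̃, R̃) = (M̃, Z̃, R̃); and (ii) for any continuous functions M, Z, R : [0, ∞) → [0, ∞) with M(0) ≤ M̃, Z(0) ≤ Z̃, R(0) ≤ R̃, and satisfying for every t ≥ 0 the componentwise inequality (M(t), Z(t), R(t)) ≤ F_{ε,δ}(M(t), Z(t), R(t)), one has M(t) ≤ M̃, Z(t) ≤ Z̃, and R(t) ≤ R̃ for all t ≥ 0. -/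
namespace MvPolynomial

variable {σ : Type*}

theorem eval_nonneg_of_coeff_nonneg {P : MvPolynomial σ ℝ} (hP : ∀ m, 0 ≤ coeff m P)
    {x : σ → ℝ} (hx : 0 ≤ x) : 0 ≤ eval x P := by
  rw [eval_eq]
  exact Finset.sum_nonneg fun d _ =>
    mul_nonneg (hP d) (Finset.prod_nonneg fun i _ => pow_nonneg (hx i) _)

theorem eval_le_eval_of_coeff_nonneg {P : MvPolynomial σ ℝ} (hP : ∀ m, 0 ≤ coeff m P)
    {x y : σ → ℝ} (hx : 0 ≤ x) (hxy : x ≤ y) : eval x P ≤ eval y P := by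
  rw [eval_eq, eval_eq]
  refine Finset.sum_le_sum fun d _ => mul_le_mul_of_nonneg_left ?_ (hP d)
  exact Finset.prod_le_prod (fun i _ => pow_nonneg (hx i) _)
    fun i _ => pow_le_pow_left₀ (hx i) (hxy i) _

/-- Real polynomials are bounded and Lipschitz on cubes. -/
theorem exists_bound_lipschitz_on_cube [Fintype σ] (P : MvPolynomial σ ℝ) (K : ℝ) :
    ∃ C L : ℝ, 0 ≤ C ∧ 0 ≤ L ∧ (∀ x : σ → ℝ, ‖x‖ ≤ K → |eval x P| ≤ C) ∧
      ∀ x y : σ → ℝ, ‖x‖ ≤ K → ‖y‖ ≤ K → |eval x P - eval y P| ≤ L * ‖x - y‖ := by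
  induction P using MvPolynomial.induction_on with
  | C a => exact ⟨|a|, 0, abs_nonneg a, le_rfl, by simp, by simp⟩
  | add p q hp hq =>
    obtain ⟨C₁, L₁, hC₁, hL₁, hb₁, hl₁⟩ := hp
    obtain ⟨C₂, L₂, hC₂, hL₂, hb₂, hl₂⟩ := hq
    refine ⟨C₁ + C₂, L₁ + L₂, by positivity, by positivity, fun x hx => ?_, fun x y hx hy => ?_⟩
    · rw [map_add]
      exact (abs_add_le _ _).trans (add_le_add (hb₁ x hx) (hb₂ x hx))
    · rw [map_add, map_add, add_sub_add_comm, add_mul]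
      exact (abs_add_le _ _).trans (add_le_add (hl₁ x y hx hy) (hl₂ x y hx hy))
  | mul_X p i hp =>
    obtain ⟨C₁, L₁, hC₁, hL₁, hb, hl⟩ := hp
    refine ⟨C₁ * |K|, L₁ * |K| + C₁, by positivity, by positivity,
      fun x hx => ?_, fun x y hx hy => ?_⟩
    · have hi : |x i| ≤ |K| := (norm_le_pi_norm x i).trans (hx.trans (le_abs_self K))
      rw [map_mul, eval_X, abs_mul]
      exact mul_le_mul (hb x hx) hi (abs_nonneg _) hC₁
    · have hi : |x i| ≤ |K| := (norm_le_pi_norm x i).trans (hx.trans (le_abs_self K))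
      have hd : |x i - y i| ≤ ‖x - y‖ := norm_le_pi_norm (x - y) i
      simp only [map_mul, eval_X]
      calc |eval x p * x i - eval y p * y i|
          = |(eval x p - eval y p) * x i + eval y p * (x i - y i)| := by ring_nf
        _ ≤ |eval x p - eval y p| * |x i| + |eval y p| * |x i - y i| := by
          rw [← abs_mul, ← abs_mul]; exact abs_add_le _ _
        _ ≤ (L₁ * ‖x - y‖) * |K| + C₁ * ‖x - y‖ := by
          gcongr
          · exact hl x y hx hy
          · exact hb y hy
        _ = (L₁ * |K| + C₁) * ‖x - y‖ := by ring

end MvPolynomial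

/-- A continuous function satisfying `y ≤ g y` cannot cross a gap `(u, v]` on which `g s < s`. -/
theorem ContinuousOn.le_of_le_comp_of_forall_lt {g y : ℝ → ℝ} {u v : ℝ}
    (hy : ContinuousOn y (Set.Ici 0)) (huv : u < v) (hg : ∀ s, u < s → s ≤ v → g s < s)
    (h0 : y 0 ≤ u) (hyg : ∀ t, 0 ≤ t → y t ≤ g (y t)) {t : ℝ} (ht : 0 ≤ t) : y t ≤ u := by
  by_contra! hlt
  obtain ⟨s, hs, hsy⟩ := intermediate_value_Icc ht (hy.mono Set.Icc_subset_Ici_self)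
    (show min (y t) v ∈ Set.Icc (y 0) (y t) from
      ⟨h0.trans (le_min hlt.le huv.le), min_le_left _ _⟩)
  have h := hg (y s) (by rw [hsy]; exact lt_min hlt huv) (by rw [hsy]; exact min_le_right _ _)
  exact (hyg s hs.1).not_gt h


/-- Bootstrap/fixed-point lemma: for `ε, δ` small, the map
`F_{ε,δ}(M,Z,R) = (c(S+1) + (δ+ε)P(M,Z), 1 + εP(M,Z), δ + εP(M,Z))` has a unique
fixed point in `Σ = [0, 2c(S+1)] × [0,2] × [0,1]`, and any continuous nonnegative
triple of functions starting below the fixed point and satisfying the componentwise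
inequality stays below the fixed point. -/
theorem stmt12 (P : MvPolynomial (Fin 2) ℝ)
    (hP : ∀ m : Fin 2 →₀ ℕ, 0 ≤ MvPolynomial.coeff m P)
    (c S : ℝ) (hc : 0 < c) (hS : 0 ≤ S) :
    ∃ δ₀ : ℝ, 0 < δ₀ ∧
      ∀ ε δ : ℝ, ε ∈ Set.Icc (0 : ℝ) δ₀ → δ ∈ Set.Icc (0 : ℝ) δ₀ →
        -- the map F_{ε,δ} and the region Σ
        (fun (F : ℝ × ℝ × ℝ → ℝ × ℝ × ℝ) (Sig : Set (ℝ × ℝ × ℝ)) =>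
          ∃ w : ℝ × ℝ × ℝ, w ∈ Sig ∧ F w = w ∧
            (∀ w' ∈ Sig, F w' = w' → w' = w) ∧
            (∀ M Z R : ℝ → ℝ,
              ContinuousOn M (Set.Ici 0) → ContinuousOn Z (Set.Ici 0) →
              ContinuousOn R (Set.Ici 0) →
              (∀ t, 0 ≤ t → 0 ≤ M t) → (∀ t, 0 ≤ t → 0 ≤ Z t) →
              (∀ t, 0 ≤ t → 0 ≤ R t) →
              M 0 ≤ w.1 → Z 0 ≤ w.2.1 → R 0 ≤ w.2.2 →
              (∀ t, 0 ≤ t →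
                M t ≤ (F (M t, Z t, R t)).1 ∧
                Z t ≤ (F (M t, Z t, R t)).2.1 ∧
                R t ≤ (F (M t, Z t, R t)).2.2) →
              ∀ t, 0 ≤ t → M t ≤ w.1 ∧ Z t ≤ w.2.1 ∧ R t ≤ w.2.2))
        (fun w : ℝ × ℝ × ℝ =>
          (c * (S + 1) + (δ + ε) * MvPolynomial.eval ![w.1, w.2.1] P,
           1 + ε * MvPolynomial.eval ![w.1, w.2.1] P,
           δ + ε * MvPolynomial.eval ![w.1, w.2.1] P))
        (Set.Icc (0 : ℝ) (2 * c * (S + 1)) ×ˢ Set.Icc (0 : ℝ) 2 ×ˢ Set.Icc (0 : ℝ) 1) := by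
  set a : ℝ := c * (S + 1) with ha_def
  have ha : 0 < a := by positivity
  have h2a : 2 * c * (S + 1) = 2 * a := by rw [ha_def]; ring
  rw [h2a]
  obtain ⟨p, hp⟩ : ∃ p : ℝ → ℝ → ℝ, ∀ M Z, MvPolynomial.eval ![M, Z] P = p M Z :=
    ⟨_, fun _ _ => rfl⟩
  simp only [hp]
  have hvec {M Z : ℝ} (hM : 0 ≤ M) (hZ : 0 ≤ Z) : (0 : Fin 2 → ℝ) ≤ ![M, Z] := by
    intro i; fin_cases i <;> simpa
  have hp0 {M Z : ℝ} (hM : 0 ≤ M) (hZ : 0 ≤ Z) : 0 ≤ p M Z :=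
    hp M Z ▸ MvPolynomial.eval_nonneg_of_coeff_nonneg hP (hvec hM hZ)
  have hpmono {M Z M' Z' : ℝ} (hM : 0 ≤ M) (hZ : 0 ≤ Z) (hMM : M ≤ M') (hZZ : Z ≤ Z') :
      p M Z ≤ p M' Z' := by
    rw [← hp, ← hp]
    refine MvPolynomial.eval_le_eval_of_coeff_nonneg hP (hvec hM hZ) ?_
    intro i; fin_cases i <;> simpa
  have hpcont : Continuous fun q : ℝ × ℝ => p q.1 q.2 := by
    simp only [← hp]
    refine (MvPolynomial.continuous_eval P).comp (continuous_pi fun i => ?_)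
    fin_cases i
    · exact continuous_fst
    · exact continuous_snd
  obtain ⟨-, L, -, hL, -, hlip⟩ := P.exists_bound_lipschitz_on_cube (2 * a + 2)
  set B := p (2 * a) 2
  have hB : 0 ≤ B := hp0 (by positivity) (by norm_num)
  obtain ⟨D, hD_def⟩ : ∃ D, D = 2 + B + 2 * (B + 1) / a + 4 * L := ⟨_, rfl⟩
  have hfrac : 0 ≤ 2 * (B + 1) / a := by positivity
  have hD : 0 < D := by linarith
  refine ⟨D⁻¹, by positivity, fun ε δ hε hδ => ?_⟩
  obtain ⟨hε0, hε1⟩ := hε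
  obtain ⟨hδ0, hδ1⟩ := hδ
  have hsmall {q : ℝ} (hq : q ≤ D) (hq0 : 0 ≤ q) : D⁻¹ * q ≤ 1 := by
    rw [inv_mul_le_iff₀ hD, mul_one]; exact hq
  have hstepM {u : ℝ} (hu0 : 0 ≤ u) (hu : u ≤ B + 1) : (δ + ε) * u ≤ a := by
    have h1 : D⁻¹ * (2 * (B + 1) / a) ≤ 1 := hsmall (by linarith) hfrac
    calc (δ + ε) * u ≤ (D⁻¹ + D⁻¹) * (B + 1) := by gcongr
      _ = D⁻¹ * (2 * (B + 1) / a) * a := by field_simp; ring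
      _ ≤ 1 * a := by gcongr
      _ = a := one_mul a
  have hstepR {u : ℝ} (hu0 : 0 ≤ u) (hu : u ≤ B + 1) : δ + ε * u ≤ 1 := by
    have h1 : D⁻¹ * (2 + B) ≤ 1 := hsmall (by linarith) (by linarith)
    have h2 : ε * u ≤ D⁻¹ * (B + 1) := by gcongr
    linarith
  set g : ℝ → ℝ := fun u => p (a + (δ + ε) * u) (1 + ε * u)
  have hgcont : Continuous g := by
    have h : Continuous fun u : ℝ => (a + (δ + ε) * u, 1 + ε * u) := by fun_prop
    exact hpcont.comp h
  have hglip {u v : ℝ} (hu0 : 0 ≤ u) (huv : u < v) (hv : v ≤ B + 1) : g v - g u < v - u := by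
    have hnorm {s : ℝ} (hs0 : 0 ≤ s) (hs : s ≤ B + 1) :
        ‖![a + (δ + ε) * s, 1 + ε * s]‖ ≤ 2 * a + 2 := by
      have h1 := hstepM hs0 hs
      have h2 := hstepR hs0 hs
      have h3 : 0 ≤ (δ + ε) * s := by positivity
      have h4 : 0 ≤ ε * s := by positivity
      rw [pi_norm_le_iff_of_nonneg (by positivity)]
      intro i
      fin_cases i
      · simp only [Fin.zero_eta, Matrix.cons_val_zero, Real.norm_eq_abs]
        rw [abs_le]; constructor <;> linarith
      · simp only [Fin.mk_one, Matrix.cons_val_one, Matrix.cons_val_fin_one, Real.norm_eq_abs]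
        rw [abs_le]; constructor <;> linarith
    have hdiff : ‖![a + (δ + ε) * v, 1 + ε * v] - ![a + (δ + ε) * u, 1 + ε * u]‖
        ≤ 2 * D⁻¹ * (v - u) := by
      have hvu : 0 ≤ v - u := by linarith
      rw [pi_norm_le_iff_of_nonneg (by positivity)]
      intro i
      fin_cases i
      · have h : a + (δ + ε) * v - (a + (δ + ε) * u) = (δ + ε) * (v - u) := by ring
        simp only [Fin.zero_eta, Pi.sub_apply, Matrix.cons_val_zero, Real.norm_eq_abs, h]
        rw [abs_of_nonneg (by positivity)]
        gcongr
        linarith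
      · have h : 1 + ε * v - (1 + ε * u) = ε * (v - u) := by ring
        simp only [Fin.mk_one, Pi.sub_apply, Matrix.cons_val_one, Matrix.cons_val_fin_one,
          Real.norm_eq_abs, h]
        rw [abs_of_nonneg (by positivity)]
        gcongr
        linarith
    have hLD : D⁻¹ * (4 * L) ≤ 1 := hsmall (by linarith) (by linarith)
    have hbound := hlip _ _ (hnorm (hu0.trans huv.le) hv) (hnorm hu0 (huv.le.trans hv))
    rw [hp, hp] at hbound
    calc g v - g u ≤ L * ‖![a + (δ + ε) * v, 1 + ε * v] - ![a + (δ + ε) * u, 1 + ε * u]‖ :=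
          (le_abs_self _).trans hbound
      _ ≤ L * (2 * D⁻¹ * (v - u)) := by gcongr
      _ = D⁻¹ * (4 * L) * ((v - u) / 2) := by ring
      _ ≤ 1 * ((v - u) / 2) := mul_le_mul_of_nonneg_right hLD (by linarith)
      _ < v - u := by linarith
  obtain ⟨u, ⟨hu0, huB⟩, hu⟩ : ∃ u ∈ Set.Icc 0 B, g u = u := by
    have hgB : g B ≤ B := by
      have h1 := hstepM hB (by linarith)
      have h2 := hstepR hB (by linarith)
      have h3 : 0 ≤ ε * B := by positivity
      exact hpmono (by positivity) (by positivity) (by linarith) (by linarith)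
    have hg0 : 0 ≤ g 0 := hp0 (by simpa using ha.le) (by simp)
    obtain ⟨u, hu, h⟩ := intermediate_value_Icc' hB (f := fun s => g s - s)
      (by fun_prop) (show (0 : ℝ) ∈ Set.Icc _ _ from ⟨by linarith, by linarith⟩)
    exact ⟨u, hu, sub_eq_zero.mp h⟩
  have hM := hstepM hu0 (by linarith)
  have hR := hstepR hu0 (by linarith)
  have hM0 : 0 ≤ (δ + ε) * u := by positivity
  have hR0 : 0 ≤ ε * u := by positivity
  refine ⟨(a + (δ + ε) * u, 1 + ε * u, δ + ε * u), ?_, ?_, ?_, ?_⟩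
  · simp only [Set.mem_prod, Set.mem_Icc]
    refine ⟨⟨?_, ?_⟩, ⟨?_, ?_⟩, ?_, ?_⟩ <;> linarith
  · change (a + (δ + ε) * g u, 1 + ε * g u, δ + ε * g u) = _
    rw [hu]
  · rintro ⟨M, Z, R⟩ hw hfix
    simp only [Set.mem_prod, Set.mem_Icc] at hw
    obtain ⟨⟨hM0, hM1⟩, ⟨hZ0, hZ1⟩, -, -⟩ := hw
    change (a + (δ + ε) * p M Z, 1 + ε * p M Z, δ + ε * p M Z) = (M, Z, R) at hfix
    have hv0 : 0 ≤ p M Z := hp0 hM0 hZ0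
    have hvB : p M Z ≤ B := hpmono hM0 hZ0 hM1 hZ1
    have hgv : g (p M Z) = p M Z := by
      simp only [Prod.mk.injEq] at hfix
      change p (a + (δ + ε) * p M Z) (1 + ε * p M Z) = p M Z
      rw [hfix.1, hfix.2.1]
    have hvu : p M Z = u := by
      rcases lt_trichotomy (p M Z) u with h | h | h
      · linarith [hglip hv0 h (by linarith)]
      · exact h
      · linarith [hglip hu0 h (by linarith)]
    rw [← hfix, hvu]
  · intro M Z R hMc hZc _ hM0 hZ0 _ hMi hZi _ hF t ht
    have hy : p (M t) (Z t) ≤ u := by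
      refine ContinuousOn.le_of_le_comp_of_forall_lt (g := g) (v := B + 1)
        (y := fun t => p (M t) (Z t)) (hpcont.comp_continuousOn (hMc.prodMk hZc))
        (by linarith) (fun s hs hsB => ?_) ?_ (fun s hs => ?_) ht
      · linarith [hglip hu0 hs hsB]
      · exact (hpmono (hM0 0 le_rfl) (hZ0 0 le_rfl) hMi hZi).trans_eq hu
      · exact hpmono (hM0 s hs) (hZ0 s hs) (hF s hs).1 (hF s hs).2.1
    obtain ⟨h1, h2, h3⟩ := hF t ht
    refine ⟨h1.trans ?_, h2.trans ?_, h3.trans ?_⟩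
    · change a + (δ + ε) * p (M t) (Z t) ≤ a + (δ + ε) * u
      gcongr
    · change 1 + ε * p (M t) (Z t) ≤ 1 + ε * u
      gcongr
    · change δ + ε * p (M t) (Z t) ≤ δ + ε * u
      gcongr
end
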